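/- arXiv:2102.04793 — 2 statements merged into one kernel-verified Lean document; each statement's English description precedes it below -/
import Mathlib

section
/- Let T̄ be an upper transition operator on ℒ(X). If T̄ is weakly ergodic, then 𝒢(T̄) has a top class. -/
open Filter Topology

namespace WeakErg

variable {X : Type*} [Fintype X] [Nonempty X]

/-- Indicator function of a set, as a real-valued function. -/
noncomputable def ind (A : Set X) : X → ℝ := A.indicator 1

/-- Upper transition operator axioms: dominated by the max, sub-additive,
non-negatively homogeneous. -/
def IsUTO (T : (X → ℝ) → (X → ℝ)) : Prop :=
  (∀ (h : X → ℝ) (x : X), T h x ≤ ⨆ y, h y) ∧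
  (∀ (h g : X → ℝ) (x : X), T (h + g) x ≤ T h x + T g x) ∧
  (∀ (l : ℝ), 0 ≤ l → ∀ h : X → ℝ, T (l • h) = l • T h)

/-- The topical map `T̄_f : h ↦ f + T̄ h`. -/
def Tf (T : (X → ℝ) → (X → ℝ)) (f : X → ℝ) : (X → ℝ) → (X → ℝ) :=
  fun h => f + T h

/-- Edge relation of the (upper) accessibility graph 𝒢(T): an edge from `x` to `y`
iff `[T 𝟙_y](x) > 0`. -/
def Edge (T : (X → ℝ) → (X → ℝ)) (x y : X) : Prop := 0 < T (ind {y}) x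

/-- Accessibility: `x = y` or there is a directed path from `x` to `y`. -/
def Acc' (T : (X → ℝ) → (X → ℝ)) : X → X → Prop := Relation.ReflTransGen (Edge T)

/-- `x` and `y` communicate. -/
def Comm (T : (X → ℝ) → (X → ℝ)) (x y : X) : Prop := Acc' T x y ∧ Acc' T y x

/-- `S` is a communication class: an equivalence class of the communication relation. -/
def IsCommClass (T : (X → ℝ) → (X → ℝ)) (S : Set X) : Prop :=
  ∃ x : X, S = {y | Comm T x y}

/-- A nonempty set `S` is closed in 𝒢(T): no state outside `S` is accessible from `S`. -/
def ClosedIn (T : (X → ℝ) → (X → ℝ)) (S : Set X) : Prop :=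
  S.Nonempty ∧ ∀ x ∈ S, ∀ y ∉ S, ¬ Acc' T x y

/-- 𝒢(T) is strongly connected. -/
def StronglyConnected (T : (X → ℝ) → (X → ℝ)) : Prop := ∀ x y : X, Acc' T x y

/-- A set `S` is absorbing for `T`: from each state outside `S` the `k`-step upper
probability of staying outside `S` drops below 1 for some `k`. -/
def Absorbing (T : (X → ℝ) → (X → ℝ)) (S : Set X) : Prop :=
  ∀ x ∉ S, ∃ k : ℕ, T^[k] (ind Sᶜ) x < 1

/-- `R` is a top class of 𝒢(T): a communication class accessible from every state. -/
def IsTopClass (T : (X → ℝ) → (X → ℝ)) (R : Set X) : Prop :=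
  IsCommClass T R ∧ ∀ x : X, ∀ y ∈ R, Acc' T x y

/-- (TCA): 𝒢(T) has a top class that is absorbing. -/
def TCA (T : (X → ℝ) → (X → ℝ)) : Prop :=
  ∃ R : Set X, IsTopClass T R ∧ Absorbing T R

/-- `T` is weakly ergodic: for every `f`, the upper expected time averages
`(1/k)·[T̄_f^k(0)](x)` converge to a limit independent of `x`. -/
def WeaklyErgodic (T : (X → ℝ) → (X → ℝ)) : Prop :=
  ∀ f : X → ℝ, ∃ μ : ℝ, ∀ x : X,
    Tendsto (fun k : ℕ => (1 / (k : ℝ)) * (Tf T f)^[k] 0 x) atTop (𝓝 μ)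

/-- `μ` is an additive eigenvalue of `G`. -/
def IsAddEigenvalue (G : (X → ℝ) → (X → ℝ)) (μ : ℝ) : Prop :=
  ∃ h : X → ℝ, G h = h + fun _ => μ

/-- A transition matrix on `X`: nonnegative entries with rows summing to one. -/
structure TransMat (Y : Type*) [Fintype Y] where
  P : Y → Y → ℝ
  nonneg : ∀ x y, 0 ≤ P x y
  rowSum : ∀ x, ∑ y, P x y = 1

/-- The action of a transition matrix on functions. -/
def TransMat.apply (T : TransMat X) (h : X → ℝ) : X → ℝ :=
  fun x => ∑ y, T.P x y * h y

/-- A set of transition matrices is separately specified. -/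
def SepSpec (𝒯 : Set (TransMat X)) : Prop :=
  ∀ T₁ ∈ 𝒯, ∀ T₂ ∈ 𝒯, ∀ A : Set X, ∃ T₃ ∈ 𝒯,
    (∀ x ∈ A, T₃.P x = T₁.P x) ∧ (∀ y ∉ A, T₃.P y = T₂.P y)

/-- `Tbar` is the upper envelope of the set `𝒯` of transition matrices. -/
def IsUpperEnv (𝒯 : Set (TransMat X)) (Tbar : (X → ℝ) → (X → ℝ)) : Prop :=
  ∀ (h : X → ℝ) (x : X), Tbar h x = ⨆ T : 𝒯, TransMat.apply T.1 h x

/-- The repetition-independent upper expected time average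
`sup_{T ∈ 𝒯} (1/k)·[T_f^k(0)](x)`. -/
noncomputable def riSeq (𝒯 : Set (TransMat X)) (f : X → ℝ) (x : X) (k : ℕ) : ℝ :=
  ⨆ T : 𝒯, (1 / (k : ℝ)) * (Tf (TransMat.apply T.1) f)^[k] 0 x

/-- Weak ergodicity of the imprecise Markov chain under repetition independence. -/
def RIWeaklyErgodic (𝒯 : Set (TransMat X)) : Prop :=
  ∀ f : X → ℝ, ∃ μ : ℝ, ∀ x : X, Tendsto (riSeq 𝒯 f x) atTop (𝓝 μ)

end WeakErg

namespace WeakErg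

lemma uto_le {X : Type*} [Fintype X] [Nonempty X] {T : (X → ℝ) → (X → ℝ)} (hT : IsUTO T)
    {h : X → ℝ} {c : ℝ} (hc : ∀ y, h y ≤ c) (x : X) : T h x ≤ c :=
  (hT.1 h x).trans (ciSup_le hc)

lemma uto_zero {X : Type*} [Fintype X] [Nonempty X] {T : (X → ℝ) → (X → ℝ)} (hT : IsUTO T)
    (x : X) : T 0 x = 0 := by
  have := congrFun (hT.2.2 0 le_rfl 0) x
  simpa using this

lemma uto_const {X : Type*} [Fintype X] [Nonempty X] {T : (X → ℝ) → (X → ℝ)} (hT : IsUTO T)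
    (c : ℝ) (x : X) : T (fun _ => c) x = c := by
  have h1 : T (fun _ => c) x ≤ c := uto_le hT (fun _ => le_rfl) x
  have h2 : T (fun _ => -c) x ≤ -c := uto_le hT (fun _ => le_rfl) x
  have h3 := hT.2.1 (fun _ => c) (fun _ => -c) x
  have h4 : ((fun _ => c) + (fun _ => -c) : X → ℝ) = 0 := by ext; simp
  rw [h4, uto_zero hT] at h3
  linarith

lemma uto_sum {X : Type*} [Fintype X] [Nonempty X] {T : (X → ℝ) → (X → ℝ)} (hT : IsUTO T)
    (F : X → X → ℝ) (s : Finset X) (x : X) : T (∑ y ∈ s, F y) x ≤ ∑ y ∈ s, T (F y) x := by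
  classical
  induction s using Finset.induction_on with
  | empty => simp [uto_zero hT]
  | insert a s ha ih =>
    rw [Finset.sum_insert ha, Finset.sum_insert ha]
    linarith [hT.2.1 (F a) (∑ y ∈ s, F y) x]

lemma uto_mono_on {X : Type*} [Fintype X] [Nonempty X] {T : (X → ℝ) → (X → ℝ)} (hT : IsUTO T)
    {C : Set X} (hC : ∀ x ∈ C, ∀ y, Edge T x y → y ∈ C) {g h : X → ℝ}
    (hgh : ∀ x ∈ C, g x ≤ h x) (x : X) (hx : x ∈ C) : T g x ≤ T h x := by
  classical
  set u : X → ℝ := ∑ y, (max (g y - h y) 0) • ind {y} with hu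
  have hux : ∀ z, u z = max (g z - h z) 0 := by
    intro z
    rw [hu, Finset.sum_apply, Finset.sum_eq_single z]
    · simp [ind]
    · intro b _ hb
      simp [ind, hb.symm]
    · simp
  have h1 : T u x ≤ 0 := by
    refine (uto_sum hT _ _ x).trans (Finset.sum_nonpos fun y _ => ?_)
    rw [hT.2.2 _ (le_max_right _ _)]
    by_cases hy : y ∈ C
    · rw [max_eq_right (by linarith [hgh y hy])]; simp
    · have : T (ind {y}) x ≤ 0 := not_lt.1 fun h => hy (hC x hx y h)
      exact mul_nonpos_of_nonneg_of_nonpos (le_max_right _ _) this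
  have h2 : T (g - h - u) x ≤ 0 := uto_le hT (fun y => by
    simp only [Pi.sub_apply, hux]
    linarith [le_max_left (g y - h y) 0]) x
  have h3 := hT.2.1 (h + u) (g - h - u) x
  have h4 := hT.2.1 h u x
  rw [show h + u + (g - h - u) = g by abel] at h3
  linarith

lemma uto_iter {X : Type*} [Fintype X] [Nonempty X] {T : (X → ℝ) → (X → ℝ)} (hT : IsUTO T)
    {C : Set X} (hC : ∀ x ∈ C, ∀ y, Edge T x y → y ∈ C) {f : X → ℝ} {c : ℝ}
    (hf : ∀ x ∈ C, f x = c) (k : ℕ) : ∀ x ∈ C, (Tf T f)^[k] 0 x = k * c := by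
  induction k with
  | zero => intro x _; simp
  | succ k ih =>
    intro x hx
    rw [Function.iterate_succ_apply']
    have h1 := uto_mono_on hT hC (g := (Tf T f)^[k] 0) (h := fun _ => k * c)
      (fun z hz => (ih z hz).le) x hx
    have h2 := uto_mono_on hT hC (h := (Tf T f)^[k] 0) (g := fun _ => k * c)
      (fun z hz => (ih z hz).ge) x hx
    rw [uto_const hT] at h1 h2
    simp only [Tf, Pi.add_apply, hf x hx] at h1 h2 ⊢
    push_cast
    linarith

lemma uto_lim {X : Type*} [Fintype X] [Nonempty X] {T : (X → ℝ) → (X → ℝ)} (hT : IsUTO T)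
    {C : Set X} (hC : ∀ x ∈ C, ∀ y, Edge T x y → y ∈ C) {f : X → ℝ} {c : ℝ}
    (hf : ∀ x ∈ C, f x = c) (x : X) (hx : x ∈ C) {μ : ℝ}
    (hμ : Tendsto (fun k : ℕ => (1 / (k : ℝ)) * (Tf T f)^[k] 0 x) atTop (𝓝 μ)) : μ = c := by
  refine tendsto_nhds_unique hμ (tendsto_const_nhds.congr' ?_)
  filter_upwards [eventually_gt_atTop 0] with k hk
  have : (k : ℝ) ≠ 0 := by positivity
  rw [uto_iter hT hC hf k x hx]
  field_simp

/-- if `T̄` is weakly ergodic, then 𝒢(T̄) has a top class. -/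
theorem topClass_of_weaklyErgodic {X : Type*} [Fintype X] [Nonempty X]
    (T : (X → ℝ) → (X → ℝ)) (hT : IsUTO T) (hwe : WeaklyErgodic T) :
    ∃ R : Set X, IsTopClass T R := by
  obtain ⟨x0, hx0⟩ := Finite.exists_min (fun x : X => Set.ncard {y | Acc' T x y})
  have hback : ∀ y, Acc' T x0 y → Acc' T y x0 := by
    intro y hy
    have hsub : {z | Acc' T y z} ⊆ {z | Acc' T x0 z} := fun z hz =>
      Relation.ReflTransGen.trans hy hz
    have heq := Set.eq_of_subset_of_ncard_le hsub (hx0 y) (Set.toFinite _)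
    have : x0 ∈ {z | Acc' T x0 z} := Relation.ReflTransGen.refl
    rw [← heq] at this
    exact this
  have hall : ∀ z, Acc' T z x0 := by
    intro z
    by_contra hz
    have hcl : ∀ w : X, ∀ x ∈ {y | Acc' T w y}, ∀ y, Edge T x y → y ∈ {y | Acc' T w y} :=
      fun w x hx y hxy => Relation.ReflTransGen.tail hx hxy
    obtain ⟨μ, hμ⟩ := hwe (ind {y | Acc' T x0 y})
    have h1 : μ = 1 := uto_lim hT (hcl x0) (fun x hx => by
      simp only [ind]; rw [Set.indicator_of_mem hx]; rfl) x0 Relation.ReflTransGen.refl (hμ x0)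
    have h0 : μ = 0 := uto_lim hT (hcl z) (fun x hx => by
      simp only [ind]
      exact Set.indicator_of_notMem (fun h => hz (Relation.ReflTransGen.trans hx (hback x h))) _)
      z Relation.ReflTransGen.refl (hμ z)
    linarith
  exact ⟨{y | Comm T x0 y}, ⟨x0, rfl⟩, fun x y hy =>
    Relation.ReflTransGen.trans (hall x) hy.1⟩

end WeakErg
end

section
/- Let 𝒯 be a nonempty, separately specified set of transition matrices on X with upper envelope T̄. If T̄ satisfies (TCA) with top class ℛ, then for every T ∈ 𝒯 the set ℛ is closed in 𝒢(T) and, for every x ∈ X∖ℛ, there is some k ∈ ℕ with [T^k 𝟙_{X∖ℛ}](x) < 1 (where T^k denotes the k-fold iterate of T); that is, ℛ is an absorbing closed class in 𝒢(T). -/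
open Filter Topology

namespace WeakErg

theorem apply_le_env {X : Type*} [Fintype X]
    (𝒯 : Set (TransMat X)) (Tbar : (X → ℝ) → (X → ℝ)) (henv : IsUpperEnv 𝒯 Tbar)
    (T : TransMat X) (hT : T ∈ 𝒯) (h : X → ℝ) : TransMat.apply T h ≤ Tbar h := by
  intro x
  rw [henv h x]
  refine le_ciSup (f := fun T : 𝒯 => TransMat.apply T.1 h x) ?_ ⟨T, hT⟩
  refine ⟨∑ y, |h y|, ?_⟩
  rintro _ ⟨S, rfl⟩
  refine Finset.sum_le_sum fun y _ => ?_
  have h1 : S.1.P x y ≤ 1 := by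
    rw [← S.1.rowSum x]
    exact Finset.single_le_sum (fun z _ => S.1.nonneg x z) (Finset.mem_univ y)
  have h0 := S.1.nonneg x y
  nlinarith [le_abs_self (h y), abs_nonneg (h y)]

theorem apply_mono {X : Type*} [Fintype X] (T : TransMat X) :
    Monotone (TransMat.apply T) := by
  intro f g hfg x
  exact Finset.sum_le_sum fun y _ => mul_le_mul_of_nonneg_left (hfg y) (T.nonneg x y)

/-- if `T̄` satisfies (TCA) with top class `ℛ`, then for every `T ∈ 𝒯`
the class `ℛ` is closed in 𝒢(T) and absorbing for `T`. -/
theorem topClass_closed_absorbing_for_members {X : Type*} [Fintype X] [Nonempty X]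
    (𝒯 : Set (TransMat X)) (hne : 𝒯.Nonempty) (hsep : SepSpec 𝒯)
    (Tbar : (X → ℝ) → (X → ℝ)) (henv : IsUpperEnv 𝒯 Tbar)
    (R : Set X) (htop : IsTopClass Tbar R) (habs : Absorbing Tbar R) :
    ∀ T ∈ 𝒯, ClosedIn (TransMat.apply T) R ∧
      ∀ x ∉ R, ∃ k : ℕ, (TransMat.apply T)^[k] (ind Rᶜ) x < 1 := by
  intro T hT
  have hle := apply_le_env 𝒯 Tbar henv T hT
  obtain ⟨⟨x₀, hR⟩, hacc⟩ := htop
  have hx₀ : x₀ ∈ R := by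
    rw [hR]
    exact ⟨Relation.ReflTransGen.refl, Relation.ReflTransGen.refl⟩
  refine ⟨⟨⟨x₀, hx₀⟩, ?_⟩, ?_⟩
  · intro x hx y hy hxy
    apply hy
    have hxy' : Acc' Tbar x y :=
      Relation.ReflTransGen.mono (fun a b hab => lt_of_lt_of_le hab (hle _ a)) _ _ hxy
    rw [hR]
    exact ⟨(hacc x₀ x hx).trans hxy', hacc y x₀ hx₀⟩
  · intro x hx
    obtain ⟨k, hk⟩ := habs x hx
    refine ⟨k, lt_of_le_of_lt ?_ hk⟩
    exact (apply_mono T).iterate_le_of_le hle k (ind Rᶜ) x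

end WeakErg
end
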